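/- arXiv:1804.01345 — 2 statements merged into one kernel-verified Lean document; each statement's English description precedes it below -/
import Mathlib

section
/- Let (X,κ) be a Giry algebra. Then the structure map κ is affine with respect to the pointwise convex structure on G(X) and the induced convex structure on X: for all probability measures φ, ψ on X and all r ∈ [0,1], κ((1−r)φ + rψ) = κ(φ) +_r κ(ψ), i.e. κ((1−r)φ + rψ) = κ((1−r)δ_{κ(φ)} + r δ_{κ(ψ)}). -/
namespace Paper

/-- A family of convex combination operations satisfies the axioms of a convex space:
unit law, idempotency, parametric commutativity and deformed parametric associativity. -/
structure IsConvexStruct {A : Type*} (comb : unitInterval → A → A → A) : Prop where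
  unit : ∀ x y, comb 0 x y = x
  idem : ∀ r x, comb r x x = x
  comm : ∀ r x y, comb r x y = comb (unitInterval.symm r) y x
  assoc : ∀ (r s t u : unitInterval), 0 < (s : ℝ) → (t : ℝ) = r + s - r * s →
    (u : ℝ) = (s : ℝ) / (t : ℝ) →
    ∀ x y z, comb s (comb r x y) z = comb t x (comb u y z)

section GiryMonad

open MeasureTheory

/-- The evaluation σ-algebra on the space `G(X)` of probability measures on `X`:
the σ-algebra induced from the σ-algebra on measures generated by the evaluations
`φ ↦ φ K` for `K` measurable. -/
noncomputable instance {X : Type*} [MeasurableSpace X] :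
    MeasurableSpace (ProbabilityMeasure X) :=
  MeasurableSpace.comap ProbabilityMeasure.toMeasure inferInstance

lemma measurable_toMeasure {X : Type*} [MeasurableSpace X] :
    Measurable (ProbabilityMeasure.toMeasure : ProbabilityMeasure X → Measure X) :=
  Measurable.of_comap_le le_rfl

/-- The Dirac measure as a probability measure: the unit of the Giry monad. -/
noncomputable def dirac {X : Type*} [MeasurableSpace X] (x : X) : ProbabilityMeasure X :=
  ⟨Measure.dirac x, inferInstance⟩

/-- Pushforward of a probability measure along a measurable map (the action of the
Giry functor on morphisms): `G(f)(φ) = φ ∘ f⁻¹`. -/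
noncomputable def pushforward {X Y : Type*} [MeasurableSpace X] [MeasurableSpace Y]
    (f : X → Y) (hf : Measurable f) (φ : ProbabilityMeasure X) : ProbabilityMeasure Y :=
  ⟨φ.toMeasure.map f, by
    constructor
    rw [Measure.map_apply hf MeasurableSet.univ]
    simp⟩

/-- The multiplication `μ_X : G(G(X)) → G(X)` of the Giry monad,
`μ_X(Φ)(K) = ∫ ξ(K) dΦ(ξ)`. -/
noncomputable def join {X : Type*} [MeasurableSpace X]
    (Φ : ProbabilityMeasure (ProbabilityMeasure X)) : ProbabilityMeasure X :=
  ⟨(Φ.toMeasure.map ProbabilityMeasure.toMeasure).join, by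
    constructor
    rw [Measure.join_apply MeasurableSet.univ,
      lintegral_map (Measure.measurable_coe MeasurableSet.univ) measurable_toMeasure]
    simp⟩

/-- The convex combination `φ +ᵣ ψ = (1-r)·φ + r·ψ` of two probability measures. -/
noncomputable def pcomb {X : Type*} [MeasurableSpace X] (r : unitInterval)
    (φ ψ : ProbabilityMeasure X) : ProbabilityMeasure X :=
  ⟨ENNReal.ofReal (1 - (r : ℝ)) • φ.toMeasure + ENNReal.ofReal (r : ℝ) • ψ.toMeasure, by
    constructor
    simp only [Measure.coe_add, Measure.coe_smul, Pi.add_apply, Pi.smul_apply,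
      measure_univ, smul_eq_mul, mul_one]
    rw [← ENNReal.ofReal_add (by linarith [r.2.2]) r.2.1]
    norm_num⟩

lemma integral_mem_unitInterval {X : Type*} [MeasurableSpace X] (φ : ProbabilityMeasure X)
    (f : X → ℝ) (h0 : ∀ x, 0 ≤ f x) (h1 : ∀ x, f x ≤ 1) :
    ∫ x, f x ∂φ.toMeasure ∈ unitInterval := by
  refine ⟨integral_nonneg h0, ?_⟩
  have h := integral_mono_of_nonneg (μ := φ.toMeasure) (f := f) (g := fun _ => (1 : ℝ))
    (Filter.Eventually.of_forall h0) (integrable_const 1) (Filter.Eventually.of_forall h1)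
  simpa using h

/-- The structure map `E : G(I) → I`, `E(ω) = ∫ x dω`, of the Giry algebra `(I, E)`. -/
noncomputable def Eop (ω : ProbabilityMeasure unitInterval) : unitInterval :=
  ⟨∫ x, (x : ℝ) ∂ω.toMeasure,
    integral_mem_unitInterval ω _ (fun x => x.2.1) (fun x => x.2.2)⟩

/-- The structure map `E_M : G(I^M) → I^M`, `E_M(φ)(m) = ∫ ev_m dφ`. -/
noncomputable def EM (M : Type*) (φ : ProbabilityMeasure (M → unitInterval)) :
    M → unitInterval :=
  fun m => ⟨∫ α, (α m : ℝ) ∂φ.toMeasure,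
    integral_mem_unitInterval φ _ (fun α => (α m).2.1) (fun α => (α m).2.2)⟩

end GiryMonad

section ConvexCombination

open MeasureTheory

lemma pushforward_dirac {X Y : Type*} [MeasurableSpace X] [MeasurableSpace Y]
    (f : X → Y) (hf : Measurable f) (x : X) : pushforward f hf (dirac x) = dirac (f x) :=
  Subtype.ext (Measure.map_dirac' hf x)

lemma join_dirac {X : Type*} [MeasurableSpace X] (φ : ProbabilityMeasure X) :
    join (dirac φ) = φ := by
  apply Subtype.ext
  change ((Measure.dirac φ).map ProbabilityMeasure.toMeasure).join = φ.toMeasure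
  rw [Measure.map_dirac' measurable_toMeasure, Measure.join_dirac]

lemma pushforward_pcomb {X Y : Type*} [MeasurableSpace X] [MeasurableSpace Y]
    (f : X → Y) (hf : Measurable f) (r : unitInterval) (φ ψ : ProbabilityMeasure X) :
    pushforward f hf (pcomb r φ ψ) = pcomb r (pushforward f hf φ) (pushforward f hf ψ) := by
  apply Subtype.ext
  change Measure.map f (_ • φ.toMeasure + _ • ψ.toMeasure) =
    _ • φ.toMeasure.map f + _ • ψ.toMeasure.map f
  rw [Measure.map_add _ _ hf, Measure.map_smul, Measure.map_smul]

lemma join_apply {X : Type*} [MeasurableSpace X]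
    (Φ : ProbabilityMeasure (ProbabilityMeasure X)) {K : Set X} (hK : MeasurableSet K) :
    (join Φ).toMeasure K = ∫⁻ ξ, ξ.toMeasure K ∂Φ.toMeasure := by
  change (Φ.toMeasure.map ProbabilityMeasure.toMeasure).join K = _
  rw [Measure.join_apply hK, lintegral_map (Measure.measurable_coe hK) measurable_toMeasure]

lemma join_pcomb {X : Type*} [MeasurableSpace X] (r : unitInterval)
    (Φ Ψ : ProbabilityMeasure (ProbabilityMeasure X)) :
    join (pcomb r Φ Ψ) = pcomb r (join Φ) (join Ψ) := by
  apply Subtype.ext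
  refine Measure.ext fun K hK => ?_
  change (join (pcomb r Φ Ψ)).toMeasure K =
    (_ • (join Φ).toMeasure + _ • (join Ψ).toMeasure) K
  rw [join_apply _ hK, Measure.add_apply, Measure.smul_apply, Measure.smul_apply,
    join_apply _ hK, join_apply _ hK]
  change ∫⁻ ξ : ProbabilityMeasure X, ξ.toMeasure K ∂(_ • Φ.toMeasure + _ • Ψ.toMeasure) = _
  rw [lintegral_add_measure, lintegral_smul_measure, lintegral_smul_measure]

end ConvexCombination

/-- For a Giry algebra `(X, κ)`, the structure map `κ` is affine from
the pointwise convex structure on `G(X)` to the induced convex structure on `X`: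
`κ((1-r)·φ + r·ψ) = κ(φ) +ᵣ κ(ψ) = κ((1-r)·δ_{κ(φ)} + r·δ_{κ(ψ)})`. -/
theorem structureMap_affine {X : Type*} [MeasurableSpace X]
    (κ : MeasureTheory.ProbabilityMeasure X → X) (hκ : Measurable κ)
    (hdirac : ∀ x, κ (dirac x) = x)
    (hjoin : ∀ Φ : MeasureTheory.ProbabilityMeasure (MeasureTheory.ProbabilityMeasure X),
      κ (pushforward κ hκ Φ) = κ (join Φ)) :
    ∀ (r : unitInterval) (φ ψ : MeasureTheory.ProbabilityMeasure X),
      κ (pcomb r φ ψ) = κ (pcomb r (dirac (κ φ)) (dirac (κ ψ))) := by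
  intro r φ ψ
  have h := hjoin (pcomb r (dirac φ) (dirac ψ))
  rw [pushforward_pcomb, pushforward_dirac, pushforward_dirac, join_pcomb, join_dirac,
    join_dirac] at h
  exact h.symm

end Paper
end

section
/- Let X be a measurable space and φ, ψ probability measures on X. Then the path map π_{φ,ψ} : [0,1] → G(X), r ↦ (1−r)φ + rψ, is a morphism of Giry algebras from (I,E) to (G(X), μ_X): π_{φ,ψ} is measurable, and for every probability measure ω on [0,1] and every measurable K ⊆ X, μ_X(G(π_{φ,ψ})(ω))(K) = (1 − E(ω))φ(K) + E(ω)ψ(K) = π_{φ,ψ}(E(ω))(K), where E(ω) = ∫ r dω(r). -/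
namespace Paper

section PathMap

open MeasureTheory

variable {X : Type*} [MeasurableSpace X]

lemma pcomb_toMeasure_apply (r : unitInterval) (φ ψ : ProbabilityMeasure X) (K : Set X) :
    (pcomb r φ ψ).toMeasure K
      = ENNReal.ofReal (1 - (r : ℝ)) * φ.toMeasure K
        + ENNReal.ofReal (r : ℝ) * ψ.toMeasure K :=
  rfl

lemma measurable_pcomb (φ ψ : ProbabilityMeasure X) :
    Measurable (fun r : unitInterval => pcomb r φ ψ) := by
  refine measurable_comap_iff.mpr ?_
  refine Measure.measurable_of_measurable_coe _ fun K _ => ?_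
  simp only [Function.comp_apply, pcomb_toMeasure_apply]
  fun_prop

lemma join_toMeasure_apply (Φ : ProbabilityMeasure (ProbabilityMeasure X)) {K : Set X}
    (hK : MeasurableSet K) :
    (join Φ).toMeasure K = ∫⁻ ξ, ξ.toMeasure K ∂Φ.toMeasure := by
  change (Φ.toMeasure.map ProbabilityMeasure.toMeasure).join K = _
  rw [Measure.join_apply hK, lintegral_map (Measure.measurable_coe hK) measurable_toMeasure]

lemma join_pushforward_toMeasure_apply {Y : Type*} [MeasurableSpace Y]
    (f : Y → ProbabilityMeasure X) (hf : Measurable f) (ω : ProbabilityMeasure Y) {K : Set X}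
    (hK : MeasurableSet K) :
    (join (pushforward f hf ω)).toMeasure K = ∫⁻ y, (f y).toMeasure K ∂ω.toMeasure := by
  rw [join_toMeasure_apply _ hK]
  change ∫⁻ ξ, ξ.toMeasure K ∂(ω.toMeasure.map f) = _
  exact lintegral_map ((Measure.measurable_coe hK).comp measurable_toMeasure) hf

lemma integrable_coe_unitInterval (ω : ProbabilityMeasure unitInterval) :
    Integrable (fun r : unitInterval => (r : ℝ)) ω.toMeasure :=
  Integrable.of_bound measurable_subtype_coe.aestronglyMeasurable 1
    (.of_forall fun r => by
      rw [Real.norm_of_nonneg r.2.1]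
      exact r.2.2)

lemma lintegral_ofReal_coe (ω : ProbabilityMeasure unitInterval) :
    ∫⁻ r : unitInterval, ENNReal.ofReal (r : ℝ) ∂ω.toMeasure = ENNReal.ofReal (Eop ω : ℝ) :=
  (ofReal_integral_eq_lintegral_ofReal (integrable_coe_unitInterval ω)
    (.of_forall fun r => r.2.1)).symm

lemma lintegral_ofReal_one_sub_coe (ω : ProbabilityMeasure unitInterval) :
    ∫⁻ r : unitInterval, ENNReal.ofReal (1 - (r : ℝ)) ∂ω.toMeasure
      = ENNReal.ofReal (1 - (Eop ω : ℝ)) := by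
  have hint := integrable_coe_unitInterval ω
  have hsub : Integrable (fun r : unitInterval => 1 - (r : ℝ)) ω.toMeasure :=
    (integrable_const 1).sub hint
  rw [← ofReal_integral_eq_lintegral_ofReal hsub
    (.of_forall fun r => sub_nonneg.2 r.2.2), integral_sub (integrable_const 1) hint]
  simp [Eop]

end PathMap

/-- For probability measures `φ, ψ` on `X`, the path map
`π_{φ,ψ} : I → G(X)`, `r ↦ (1-r)·φ + r·ψ`, is a morphism of Giry algebras
`(I, E) → (G(X), μ_X)`: it is measurable and for every probability measure `ω` on `I`
and measurable `K ⊆ X`,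
`μ_X(G(π)(ω))(K) = (1 - E ω)·φ(K) + (E ω)·ψ(K) = π(E ω)(K)`. -/
theorem pathMap_pcomb_giry_morphism {X : Type*} [MeasurableSpace X]
    (φ ψ : MeasureTheory.ProbabilityMeasure X) :
    ∃ hm : Measurable (fun r : unitInterval => pcomb r φ ψ),
      ∀ (ω : MeasureTheory.ProbabilityMeasure unitInterval)
        (K : Set X), MeasurableSet K →
        (join (pushforward (fun r : unitInterval => pcomb r φ ψ) hm ω)).toMeasure K
            = ENNReal.ofReal (1 - (Eop ω : ℝ)) * φ.toMeasure K
              + ENNReal.ofReal ((Eop ω : ℝ)) * ψ.toMeasure K ∧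
        (join (pushforward (fun r : unitInterval => pcomb r φ ψ) hm ω)).toMeasure K
            = (pcomb (Eop ω) φ ψ).toMeasure K := by
  refine ⟨measurable_pcomb φ ψ, fun ω K hK => ?_⟩
  rw [pcomb_toMeasure_apply, and_self, join_pushforward_toMeasure_apply _ _ _ hK]
  simp only [pcomb_toMeasure_apply]
  rw [MeasureTheory.lintegral_add_left (by fun_prop),
    MeasureTheory.lintegral_mul_const _ (by fun_prop),
    MeasureTheory.lintegral_mul_const _ (by fun_prop),
    lintegral_ofReal_one_sub_coe, lintegral_ofReal_coe]

end Paper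
end
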